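/- Let a ≥ b ≥ 1 be integers, n = a + b + 2, and let y_3 be the smallest root of p_{a,b}(x) = x³ − (a+b+4)x² + (ab+2a+2b+5)x − (a+b+2). Then the algebraic connectivity (second smallest Laplacian eigenvalue) of the double star T(a,b) is equal to y_3, it satisfies y_3 > 2/n, and for every integer k with 2 ≤ k ≤ n one has S_k(T(a,b)) < n + k − 2/n. -/

import Mathlib

open Polynomial

namespace LapPaper

variable {V : Type} [Fintype V] [DecidableEq V]

/-- The multiset of Laplacian eigenvalues of `G` (with multiplicity), given as the
real roots of the characteristic polynomial of the Laplacian matrix `L = D - A`. -/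
noncomputable def lapSpectrum (G : SimpleGraph V) [DecidableRel G.Adj] : Multiset ℝ :=
  (G.lapMatrix ℝ).charpoly.roots

/-- The average degree `d̄ = 2|E|/n` of a graph. -/
noncomputable def avgDeg (G : SimpleGraph V) [DecidableRel G.Adj] : ℝ :=
  2 * G.edgeFinset.card / Fintype.card V

/-- The Laplacian energy `LE(G) = ∑_i |μ_i - d̄|`. -/
noncomputable def LE (G : SimpleGraph V) [DecidableRel G.Adj] : ℝ :=
  ((lapSpectrum G).map (fun x => |x - avgDeg G|)).sum

/-- `Sk G k` is the sum of the `k` largest Laplacian eigenvalues `μ_1 + ⋯ + μ_k` of `G`. -/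
noncomputable def Sk (G : SimpleGraph V) [DecidableRel G.Adj] (k : ℕ) : ℝ :=
  ((((lapSpectrum G).sort (· ≤ ·)).reverse).take k).sum

/-- The number `σ` of Laplacian eigenvalues of `G` strictly larger than the average degree. -/
noncomputable def sigma (G : SimpleGraph V) [DecidableRel G.Adj] : ℕ :=
  Multiset.card ((lapSpectrum G).filter (fun x => avgDeg G < x))

/-- The double star `T(a,b)` on `a + b + 2` vertices: vertex `0` is adjacent to vertex `1`
and to the `a` leaves `2, …, a+1`; vertex `1` is adjacent to the `b` leaves `a+2, …, a+b+1`. -/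
def doubleStar (a b : ℕ) : SimpleGraph (Fin (a + b + 2)) :=
  SimpleGraph.fromRel (fun u v =>
    (u.1 = 0 ∧ v.1 = 1) ∨ (u.1 = 0 ∧ 2 ≤ v.1 ∧ v.1 < a + 2) ∨ (u.1 = 1 ∧ a + 2 ≤ v.1))

noncomputable instance (a b : ℕ) : DecidableRel (doubleStar a b).Adj := Classical.decRel _

/-- The star on `n` vertices: vertex `0` is adjacent to all other vertices. -/
def starGraph (n : ℕ) : SimpleGraph (Fin n) :=
  SimpleGraph.fromRel (fun u _ => u.1 = 0)

noncomputable instance (n : ℕ) : DecidableRel (starGraph n).Adj := Classical.decRel _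

end LapPaper

namespace LapPaper

/-- The hub vertices, the leaves at `0` and the leaves at `1`, as the vertices of `T(a,b)`. -/
def doubleStarEquiv (a b : ℕ) : Fin 2 ⊕ (Fin a ⊕ Fin b) ≃ Fin (a + b + 2) :=
  ((Equiv.refl (Fin 2)).sumCongr finSumFinEquiv).trans
    (finSumFinEquiv.trans (finCongr (Nat.add_comm 2 (a + b))))

lemma doubleStarEquiv_inl (a b : ℕ) (i : Fin 2) :
    (doubleStarEquiv a b (Sum.inl i)).1 = i.1 := by
  simp [doubleStarEquiv]

lemma doubleStarEquiv_inr_inl (a b : ℕ) (i : Fin a) :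
    (doubleStarEquiv a b (Sum.inr (Sum.inl i))).1 = i.1 + 2 := by
  simp [doubleStarEquiv]

lemma doubleStarEquiv_inr_inr (a b : ℕ) (i : Fin b) :
    (doubleStarEquiv a b (Sum.inr (Sum.inr i))).1 = a + i.1 + 2 := by
  simp [doubleStarEquiv]

lemma doubleStar_adj_iff (a b : ℕ) (u v : Fin (a + b + 2)) :
    (doubleStar a b).Adj u v ↔
      ((u.1 = 0 ∧ v.1 = 1) ∨ (u.1 = 0 ∧ 2 ≤ v.1 ∧ v.1 < a + 2) ∨ (u.1 = 1 ∧ a + 2 ≤ v.1)) ∨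
      ((v.1 = 0 ∧ u.1 = 1) ∨ (v.1 = 0 ∧ 2 ≤ u.1 ∧ u.1 < a + 2) ∨ (v.1 = 1 ∧ a + 2 ≤ u.1)) := by
  rw [doubleStar, SimpleGraph.fromRel_adj, Ne, Fin.ext_iff]
  omega

/-- The adjacency matrix of `T(a,b)` between a hub and a leaf. -/
def hubLeaf (a b : ℕ) : Matrix (Fin 2) (Fin a ⊕ Fin b) ℝ :=
  Matrix.of ![Sum.elim 1 0, Sum.elim 0 1]

lemma doubleStar_degree (a b : ℕ) (v : Fin 2 ⊕ (Fin a ⊕ Fin b)) :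
    ((doubleStar a b).degree (doubleStarEquiv a b v) : ℝ) =
      Sum.elim ![(a : ℝ) + 1, (b : ℝ) + 1] (fun _ => 1) v := by
  rw [SimpleGraph.degree_eq_sum_if_adj, ← (doubleStarEquiv a b).sum_comp]
  rcases v with v | v | v
  · fin_cases v <;>
    simp only [Fintype.sum_sum_type, doubleStar_adj_iff, doubleStarEquiv_inl,
      doubleStarEquiv_inr_inl, doubleStarEquiv_inr_inr] <;>
    simp [-Finset.sum_boole, Fin.sum_univ_two, fun i : Fin a => i.isLt.not_ge, add_comm]
  all_goals
    simp only [Fintype.sum_sum_type, doubleStar_adj_iff, doubleStarEquiv_inl,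
      doubleStarEquiv_inr_inl, doubleStarEquiv_inr_inr]
    simp [-Finset.sum_boole, Fin.sum_univ_two, v.isLt]

lemma doubleStar_lapMatrix_submatrix (a b : ℕ) :
    ((doubleStar a b).lapMatrix ℝ).submatrix (doubleStarEquiv a b) (doubleStarEquiv a b) =
      Matrix.fromBlocks !![(a : ℝ) + 1, -1; -1, (b : ℝ) + 1] (-hubLeaf a b)
        (-(hubLeaf a b).transpose) 1 := by
  ext u v
  rw [Matrix.submatrix_apply, SimpleGraph.lapMatrix, Matrix.sub_apply, SimpleGraph.degMatrix,
    Matrix.diagonal_apply, doubleStar_degree, SimpleGraph.adjMatrix_apply]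
  simp only [EmbeddingLike.apply_eq_iff_eq, doubleStar_adj_iff]
  rcases u with u | u | u <;> rcases v with v | v | v <;>
  try fin_cases u
  all_goals try fin_cases v
  all_goals
    simp [doubleStarEquiv_inl, doubleStarEquiv_inr_inl,
      doubleStarEquiv_inr_inr, hubLeaf, Matrix.one_apply]

lemma doubleStar_charpoly_eval (a b : ℕ) (x : ℝ) (hx : x ≠ 1) :
    ((doubleStar a b).lapMatrix ℝ).charpoly.eval x * (x - 1) ^ 2 =
      (x - 1) ^ (a + b) * (x * (x ^ 3 - ((a : ℝ) + b + 4) * x ^ 2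
        + ((a : ℝ) * b + 2 * a + 2 * b + 5) * x - ((a : ℝ) + b + 2))) := by
  have hx' : x - 1 ≠ 0 := sub_ne_zero.2 hx
  rw [← Matrix.charpoly_reindex (doubleStarEquiv a b).symm, Matrix.reindex_apply, Equiv.symm_symm,
    doubleStar_lapMatrix_submatrix, Matrix.eval_charpoly]
  have hsplit : Matrix.scalar (Fin 2 ⊕ (Fin a ⊕ Fin b)) x -
      Matrix.fromBlocks !![(a : ℝ) + 1, -1; -1, (b : ℝ) + 1] (-hubLeaf a b)
        (-(hubLeaf a b).transpose) 1 =
      Matrix.fromBlocks !![x - (a + 1), 1; 1, x - (b + 1)] (hubLeaf a b)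
        (hubLeaf a b).transpose ((x - 1) • 1) := by
    ext u v
    rcases u with u | u <;> rcases v with v | v
    · fin_cases u <;> fin_cases v <;> simp
    · simp
    · simp
    · by_cases h : u = v <;> simp [h]
  let : Invertible ((x - 1) • (1 : Matrix (Fin a ⊕ Fin b) (Fin a ⊕ Fin b) ℝ)) :=
    ⟨(x - 1)⁻¹ • 1, by simp [hx', smul_smul], by simp [hx', smul_smul]⟩
  have hinv : ⅟((x - 1) • (1 : Matrix (Fin a ⊕ Fin b) (Fin a ⊕ Fin b) ℝ)) = (x - 1)⁻¹ • 1 := rfl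
  have hgram : hubLeaf a b * (hubLeaf a b).transpose = !![(a : ℝ), 0; 0, (b : ℝ)] := by
    ext i j
    fin_cases i <;> fin_cases j <;>
      simp [hubLeaf, Matrix.mul_apply, Fintype.sum_sum_type]
  rw [hsplit, Matrix.det_fromBlocks₂₂, hinv, Matrix.mul_smul, Matrix.mul_one, Matrix.smul_mul,
    hgram, Matrix.det_smul, Matrix.det_one, Matrix.det_fin_two]
  simp
  field_simp
  ring

lemma doubleStar_charpoly (a b : ℕ) (y1 y2 y3 : ℝ)
    (hp : ∀ x : ℝ, x ^ 3 - ((a : ℝ) + b + 4) * x ^ 2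
        + ((a : ℝ) * b + 2 * a + 2 * b + 5) * x - ((a : ℝ) + b + 2) =
        (x - y1) * (x - y2) * (x - y3)) (m : ℕ) (hm : a + b = m + 2) :
    ((doubleStar a b).lapMatrix ℝ).charpoly =
      ((0 ::ₘ y3 ::ₘ (Multiset.replicate m 1 + {y2, y1}) : Multiset ℝ).map
        (fun r => X - C r)).prod := by
  refine Polynomial.eq_of_infinite_eval_eq _ _
    ((Set.finite_singleton (1 : ℝ)).infinite_compl.mono ?_)
  intro x hx
  have hx' : x - 1 ≠ 0 := sub_ne_zero.2 hx
  have h := doubleStar_charpoly_eval a b x hx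
  have hpow : (x - 1) ^ (a + b) = (x - 1) ^ m * (x - 1) ^ 2 := by rw [hm, pow_add]
  rw [hp, hpow] at h
  refine mul_right_cancel₀ (pow_ne_zero 2 hx') (h.trans ?_)
  simp
  ring

lemma doubleStar_sort_lapSpectrum (a b : ℕ) (y1 y2 y3 : ℝ)
    (hp : ∀ x : ℝ, x ^ 3 - ((a : ℝ) + b + 4) * x ^ 2
        + ((a : ℝ) * b + 2 * a + 2 * b + 5) * x - ((a : ℝ) + b + 2) =
        (x - y1) * (x - y2) * (x - y3)) (m : ℕ) (hm : a + b = m + 2)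
    (h0 : 0 ≤ y3) (h3 : y3 ≤ 1) (h2 : 1 ≤ y2) (h1 : y2 ≤ y1) :
    (lapSpectrum (doubleStar a b)).sort (· ≤ ·) =
      0 :: y3 :: (List.replicate m 1 ++ [y2, y1]) := by
  rw [lapSpectrum, doubleStar_charpoly a b y1 y2 y3 hp m hm,
    Polynomial.roots_multiset_prod_X_sub_C]
  refine List.Perm.eq_of_pairwise' (r := (· ≤ ·)) (Multiset.pairwise_sort _ _) ?_ ?_
  · simp [List.pairwise_append, List.pairwise_replicate]
    grind
  · rw [← Multiset.coe_eq_coe, Multiset.sort_eq]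
    rfl

lemma doubleStar_cubic_factor (a b : ℕ) (hab : b ≤ a) (hb : 1 ≤ b) (y3 : ℝ)
    (hroot : y3 ^ 3 - ((a : ℝ) + b + 4) * y3 ^ 2 + ((a : ℝ) * b + 2 * a + 2 * b + 5) * y3
        - ((a : ℝ) + b + 2) = 0)
    (hmin : ∀ y : ℝ, y ^ 3 - ((a : ℝ) + b + 4) * y ^ 2 + ((a : ℝ) * b + 2 * a + 2 * b + 5) * y
        - ((a : ℝ) + b + 2) = 0 → y3 ≤ y) :
    ∃ y1 y2 : ℝ, (∀ x : ℝ, x ^ 3 - ((a : ℝ) + b + 4) * x ^ 2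
        + ((a : ℝ) * b + 2 * a + 2 * b + 5) * x - ((a : ℝ) + b + 2) =
        (x - y1) * (x - y2) * (x - y3)) ∧ y3 < 1 ∧ 1 < y2 ∧ y2 < y1 := by
  have hb' : (1 : ℝ) ≤ b := by exact_mod_cast hb
  have hab' : (b : ℝ) ≤ a := by exact_mod_cast hab
  set p : ℝ → ℝ := fun x => x ^ 3 - ((a : ℝ) + b + 4) * x ^ 2
        + ((a : ℝ) * b + 2 * a + 2 * b + 5) * x - ((a : ℝ) + b + 2) with hpdef
  have hcont : Continuous p := by fun_prop
  have p0 : p 0 < 0 := by simp [hpdef]; linarith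
  have p1 : 0 < p 1 := by simp only [hpdef]; nlinarith
  have pb : p (b + 2) < 0 := by
    have h : ((b : ℝ) + 2) * p (b + 2) = (b + 2) * (b - a) + 1 - (b + 1) ^ 2 := by
      simp only [hpdef]; ring
    nlinarith
  obtain ⟨y, hy, hy0⟩ := intermediate_value_Ioo zero_le_one hcont.continuousOn ⟨p0, p1⟩
  obtain ⟨y2, hy2, hy20⟩ := intermediate_value_Ioo' (show (1 : ℝ) ≤ b + 2 by linarith)
    hcont.continuousOn ⟨pb, p1⟩
  have h3 : y3 < 1 := (hmin y hy0).trans_lt hy.2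
  have hq : y2 ^ 2 + y2 * y3 + y3 ^ 2 - ((a : ℝ) + b + 4) * (y2 + y3)
      + ((a : ℝ) * b + 2 * a + 2 * b + 5) = 0 := by
    have hne : y2 - y3 ≠ 0 := by linarith [hy2.1]
    refine mul_left_cancel₀ hne ?_
    simp only [hpdef] at hy20
    linear_combination hy20 - hroot
  have hfac : ∀ x, p x = (x - (a + b + 4 - y2 - y3)) * (x - y2) * (x - y3) := by
    intro x
    simp only [hpdef]
    linear_combination (x - y3) * hq + hroot
  refine ⟨a + b + 4 - y2 - y3, y2, hfac, h3, hy2.1, ?_⟩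
  rw [hfac] at pb
  have e2 : 0 < (b : ℝ) + 2 - y2 := sub_pos.2 hy2.2
  have e3 : 0 < (b : ℝ) + 2 - y3 := by linarith
  by_contra! hle
  have e1 : 0 ≤ (b : ℝ) + 2 - (a + b + 4 - y2 - y3) := by linarith
  exact absurd pb (not_lt.2 (mul_nonneg (mul_nonneg e1 e2.le) e3.le))

/-- Let `a ≥ b ≥ 1`, `n = a + b + 2`, and let `y₃` be the smallest real root
of `p_{a,b}(x) = x³ - (a+b+4)x² + (ab+2a+2b+5)x - (a+b+2)`. Then the algebraic
connectivity (the second smallest Laplacian eigenvalue) of the double star `T(a,b)`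
equals `y₃`, it satisfies `y₃ > 2/n`, and `S_k(T(a,b)) < n + k - 2/n` for `2 ≤ k ≤ n`. -/
theorem doubleStar_algConnectivity (a b : ℕ) (hab : b ≤ a) (hb : 1 ≤ b)
    (n : ℕ) (hn : n = a + b + 2) (y3 : ℝ)
    (hroot : y3 ^ 3 - ((a : ℝ) + b + 4) * y3 ^ 2 + ((a : ℝ) * b + 2 * a + 2 * b + 5) * y3
        - ((a : ℝ) + b + 2) = 0)
    (hmin : ∀ y : ℝ, y ^ 3 - ((a : ℝ) + b + 4) * y ^ 2 + ((a : ℝ) * b + 2 * a + 2 * b + 5) * y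
        - ((a : ℝ) + b + 2) = 0 → y3 ≤ y) :
    ((lapSpectrum (doubleStar a b)).sort (· ≤ ·)).getD 1 0 = y3 ∧
      2 / (n : ℝ) < y3 ∧
      ∀ k : ℕ, 2 ≤ k → k ≤ n → Sk (doubleStar a b) k < (n : ℝ) + k - 2 / n := by
  obtain ⟨y1, y2, hfac, h3, h2, h1⟩ := doubleStar_cubic_factor a b hab hb y3 hroot hmin
  obtain ⟨m, hm⟩ : ∃ m, a + b = m + 2 := ⟨a + b - 2, by omega⟩
  have hnm : (n : ℝ) = a + b + 2 := by rw [hn]; push_cast; ring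
  have hmR : (a : ℝ) + b = m + 2 := by exact_mod_cast hm
  have hn4 : (4 : ℝ) ≤ n := by rw [hnm, hmR]; linarith [m.cast_nonneg (α := ℝ)]
  have hn0 : (0 : ℝ) < n := by linarith
  have hlt1 : 2 / (n : ℝ) < 1 := by rw [div_lt_one hn0]; linarith
  have hy3 : 2 / (n : ℝ) < y3 := by
    by_contra! hle
    have hnonneg : 0 ≤ (2 / (n : ℝ) - y1) * (2 / (n : ℝ) - y2) * (2 / (n : ℝ) - y3) :=
      mul_nonneg (mul_nonneg_of_nonpos_of_nonpos (by linarith) (by linarith)) (by linarith)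
    rw [← hfac] at hnonneg
    have hsum : (a : ℝ) + b = n - 2 := by linarith
    have hprod : (a : ℝ) * b ≤ (n - 2) ^ 2 / 4 := by
      rw [← hsum]; nlinarith [sq_nonneg ((a : ℝ) - b)]
    set t : ℝ := 2 / (n : ℝ) with ht
    have htn : t * n = 2 := by rw [ht]; field_simp
    have ht0 : 0 < t := by positivity
    have hmul : (a : ℝ) * b * t ≤ (n - 2) ^ 2 / 4 * t :=
      mul_le_mul_of_nonneg_right hprod ht0.le
    have hval : t ^ 3 - ((a : ℝ) + b + 4) * t ^ 2 + ((a : ℝ) * b + 2 * a + 2 * b + 5) * t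
        - ((a : ℝ) + b + 2) ≤ t ^ 3 - 2 * t ^ 2 + 2 - n / 2 := by
      have e1 : (n - 2) ^ 2 / 4 * t = n / 2 - 2 + t := by
        linear_combination ((n : ℝ) / 4 - 1) * htn
      have e2 : ((a : ℝ) + b + 4) * t ^ 2 = 2 * t + 2 * t ^ 2 := by
        linear_combination t ^ 2 * hsum + t * htn
      have e3 : (2 * (a : ℝ) + 2 * b) * t = 4 - 4 * t := by
        linear_combination 2 * t * hsum + 2 * htn
      linarith
    nlinarith [mul_pos ht0 ht0]
  have hsort := doubleStar_sort_lapSpectrum a b y1 y2 y3 hfac m hm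
    ((by positivity : 0 ≤ 2 / (n : ℝ)).trans hy3.le) h3.le h2.le h1.le
  have htrace : y1 + y2 + y3 = n + 2 := by
    have e0 := hfac 0
    have e1 := hfac 1
    have e2 := hfac (-1)
    linarith
  refine ⟨by rw [hsort]; rfl, hy3, fun k hk2 hkn => ?_⟩
  rw [Sk, hsort]
  have hrev : (0 :: y3 :: (List.replicate m 1 ++ [y2, y1])).reverse =
      y1 :: y2 :: (List.replicate m 1 ++ [y3, 0]) := by simp
  rw [hrev]
  obtain ⟨j, rfl⟩ : ∃ j, k = j + 2 := ⟨k - 2, by omega⟩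
  rw [List.take_succ_cons, List.take_succ_cons, List.take_append, List.take_replicate,
    List.length_replicate, List.sum_cons, List.sum_cons, List.sum_append, List.sum_replicate]
  push_cast
  rcases Nat.lt_or_ge m j with hj | hj
  · obtain rfl | rfl : j = m + 1 ∨ j = m + 2 := by omega
    · simp
      linarith
    · simp
      linarith
  · simp [hj]
    linarith

end LapPaper
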